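/- Let (Φᵢ, E₊,ᵢ, E₋,ᵢ) be generalized almost contact structures on Wᵢ = Vᵢ × Vᵢ* with compatible generalized metrics Gᵢ (i = 1, 2), let 𝒥₁ be the induced generalized almost complex structure on W₁ × W₂, and let G := G₁ × G₂. Then G∘𝒥₁ = 𝒥₁∘G, so 𝒥₂ := G∘𝒥₁ is a generalized almost complex structure on W₁ × W₂ with 𝒥₁∘𝒥₂ = 𝒥₂∘𝒥₁ and −𝒥₁∘𝒥₂ = G. Moreover, if each Gᵢ is positive definite (⟨Gᵢw, w⟩ > 0 for all w ≠ 0 in Wᵢ), then G is positive definite on W₁ × W₂. -/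

import Mathlib

open Module

noncomputable section

/-- The generalized tangent space `W = V × V*`. -/
abbrev GT (V : Type*) [AddCommGroup V] [Module ℝ V] := V × (V →ₗ[ℝ] ℝ)

/-- The canonical symmetric pairing `⟨(X,α),(Y,β)⟩ = (β X + α Y)/2` on `W = V × V*`. -/
def gpair {V : Type*} [AddCommGroup V] [Module ℝ V] (u v : GT V) : ℝ :=
  (v.2 u.1 + u.2 v.1) / 2

/-- The sum pairing on the product `W₁ × W₂`. -/
def gpairProd {V₁ V₂ : Type*} [AddCommGroup V₁] [Module ℝ V₁] [AddCommGroup V₂]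
    [Module ℝ V₂] (p q : GT V₁ × GT V₂) : ℝ :=
  gpair p.1 q.1 + gpair p.2 q.2

section Pairing

variable {V : Type*} [AddCommGroup V] [Module ℝ V]

theorem gpair_comm (u v : GT V) : gpair u v = gpair v u := by
  unfold gpair; ring

theorem gpair_add_right (u v w : GT V) : gpair u (v + w) = gpair u v + gpair u w := by
  simp only [gpair, Prod.fst_add, Prod.snd_add, LinearMap.add_apply, map_add]; ring

theorem gpair_smul_right (c : ℝ) (u v : GT V) : gpair u (c • v) = c * gpair u v := by
  simp only [gpair, Prod.smul_fst, Prod.smul_snd, LinearMap.smul_apply, map_smul, smul_eq_mul]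
  ring

theorem gpair_neg_right (u v : GT V) : gpair u (-v) = -gpair u v := by
  simp only [gpair, Prod.fst_neg, Prod.snd_neg, LinearMap.neg_apply, map_neg]; ring

theorem gpair_sub_right (u v w : GT V) : gpair u (v - w) = gpair u v - gpair u w := by
  rw [sub_eq_add_neg, gpair_add_right, gpair_neg_right, sub_eq_add_neg]

theorem gpair_add_left (u v w : GT V) : gpair (u + v) w = gpair u w + gpair v w := by
  simp only [gpair_comm _ w, gpair_add_right]

theorem gpair_smul_left (c : ℝ) (u v : GT V) : gpair (c • u) v = c * gpair u v := by
  simp only [gpair_comm _ v, gpair_smul_right]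

theorem gpair_sub_left (u v w : GT V) : gpair (u - v) w = gpair u w - gpair v w := by
  simp only [gpair_comm _ w, gpair_sub_right]

/-- A generalized almost contact structure `Φ` annihilates its isotropic sections. -/
theorem contact_apply_eq_zero {Φ : GT V →ₗ[ℝ] GT V} {Ep Em : GT V}
    (hskew : ∀ u v : GT V, gpair (Φ u) v = - gpair u (Φ v))
    (hsq : ∀ w : GT V, Φ (Φ w) = -w + (2 * gpair Em w) • Ep + (2 * gpair Ep w) • Em)
    (hpp : gpair Ep Ep = 0) (hpm : 2 * gpair Ep Em = 1) : Φ Ep = 0 := by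
  have hsq_zero : Φ (Φ Ep) = 0 := by
    rw [hsq, gpair_comm Em, hpm, hpp]; simp
  have hself : gpair Ep (Φ Ep) = 0 := by
    have := hskew Ep Ep
    rw [gpair_comm (Φ Ep)] at this
    linarith
  have heigen : Φ Ep = (2 * gpair Em (Φ Ep)) • Ep := by
    have := hsq (Φ Ep)
    rw [hsq_zero, map_zero, hself, mul_zero, zero_smul, add_zero] at this
    exact (neg_add_eq_zero.mp this.symm)
  set c := 2 * gpair Em (Φ Ep)
  have hcc : c * c = 0 := by
    rw [heigen, map_smul, heigen, smul_smul] at hsq_zero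
    have := congrArg (gpair Em) hsq_zero
    rw [gpair_smul_right, gpair_comm Em Ep] at this
    have hzero : gpair Em 0 = 0 := by simp [gpair]
    rw [hzero] at this
    linear_combination 2 * this - c * c * hpm
  rw [heigen, mul_self_eq_zero.mp hcc, zero_smul]

/-- A compatible generalized metric exchanges the two isotropic sections. -/
theorem metric_apply_eq {Φ G : GT V →ₗ[ℝ] GT V} {Ep Em : GT V}
    (hΦp : Φ Ep = 0) (hpp : gpair Ep Ep = 0) (hpm : 2 * gpair Ep Em = 1)
    (hGc : ∀ w : GT V,
      -(Φ (G (Φ w))) = G w - (2 * gpair Ep w) • Ep - (2 * gpair Em w) • Em) :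
    G Ep = Em := by
  have := hGc Ep
  rw [hΦp, map_zero, map_zero, hpp, gpair_comm Em, hpm, mul_zero, zero_smul, one_smul,
    sub_zero, neg_zero] at this
  exact sub_eq_zero.mp this.symm

/-- A compatible generalized metric commutes with `Φ`. -/
theorem metric_comm_contact {Φ G : GT V →ₗ[ℝ] GT V} {Ep Em : GT V}
    (hsq : ∀ w : GT V, Φ (Φ w) = -w + (2 * gpair Em w) • Ep + (2 * gpair Ep w) • Em)
    (hΦp : Φ Ep = 0) (hΦm : Φ Em = 0)
    (hpG : ∀ w : GT V, gpair Ep (G w) = gpair Em w)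
    (hmG : ∀ w : GT V, gpair Em (G w) = gpair Ep w)
    (hpΦ : ∀ w : GT V, gpair Ep (Φ w) = 0) (hmΦ : ∀ w : GT V, gpair Em (Φ w) = 0)
    (hGc : ∀ w : GT V,
      -(Φ (G (Φ w))) = G w - (2 * gpair Ep w) • Ep - (2 * gpair Em w) • Em)
    (w : GT V) : G (Φ w) = Φ (G w) := by
  have := congrArg Φ (hGc w)
  rw [map_neg, hsq, hpG, hmG, hpΦ, hmΦ] at this
  simpa [hΦp, hΦm] using this

/-- The algebraic identities satisfied by a generalized almost contact metric structure. -/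
theorem contact_metric_identities {Φ G : GT V →ₗ[ℝ] GT V} {Ep Em : GT V}
    (hskew : ∀ u v : GT V, gpair (Φ u) v = - gpair u (Φ v))
    (hsq : ∀ w : GT V, Φ (Φ w) = -w + (2 * gpair Em w) • Ep + (2 * gpair Ep w) • Em)
    (hpp : gpair Ep Ep = 0) (hmm : gpair Em Em = 0) (hpm : 2 * gpair Ep Em = 1)
    (hGsa : ∀ u v : GT V, gpair (G u) v = gpair u (G v))
    (hGc : ∀ w : GT V,
      -(Φ (G (Φ w))) = G w - (2 * gpair Ep w) • Ep - (2 * gpair Em w) • Em) :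
    Φ Ep = 0 ∧ Φ Em = 0 ∧ G Ep = Em ∧ G Em = Ep ∧
      (∀ w, gpair Ep (Φ w) = 0) ∧ (∀ w, gpair Em (Φ w) = 0) ∧
      (∀ w, gpair Ep (G w) = gpair Em w) ∧ (∀ w, gpair Em (G w) = gpair Ep w) ∧
      (∀ w, G (Φ w) = Φ (G w)) := by
  have hmp : 2 * gpair Em Ep = 1 := by rw [gpair_comm, hpm]
  have hΦp := contact_apply_eq_zero hskew hsq hpp hpm
  have hΦm := contact_apply_eq_zero hskew (fun w => by rw [hsq, add_right_comm]) hmm hmp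
  have hGp := metric_apply_eq hΦp hpp hpm hGc
  have hGm := metric_apply_eq hΦm hmm hmp (fun w => by rw [hGc, sub_right_comm])
  have hpΦ : ∀ w, gpair Ep (Φ w) = 0 := fun w => by
    have := hskew Ep w
    rw [hΦp] at this
    simpa [gpair] using this
  have hmΦ : ∀ w, gpair Em (Φ w) = 0 := fun w => by
    have := hskew Em w
    rw [hΦm] at this
    simpa [gpair] using this
  have hpG : ∀ w, gpair Ep (G w) = gpair Em w := fun w => by rw [← hGsa, hGp]
  have hmG : ∀ w, gpair Em (G w) = gpair Ep w := fun w => by rw [← hGsa, hGm]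
  exact ⟨hΦp, hΦm, hGp, hGm, hpΦ, hmΦ, hpG, hmG,
    metric_comm_contact hsq hΦp hΦm hpG hmG hpΦ hmΦ hGc⟩

theorem gpair_metric_nonneg {G : GT V →ₗ[ℝ] GT V}
    (hG : ∀ w : GT V, w ≠ 0 → 0 < gpair (G w) w) (w : GT V) : 0 ≤ gpair (G w) w := by
  rcases eq_or_ne w 0 with rfl | hw
  · simp [gpair]
  · exact (hG w hw).le

end Pairing

/-- With generalized almost contact metric structures `(Φᵢ, E₊ᵢ, E₋ᵢ, Gᵢ)`
on `Wᵢ`, the product metric `G = G₁ × G₂` commutes with the induced generalized almost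
complex structure `𝒥₁` on `W₁ × W₂`, so `𝒥₂ := G∘𝒥₁` is a generalized almost complex
structure commuting with `𝒥₁` and `−𝒥₁∘𝒥₂ = G`; if each `Gᵢ` is positive definite then
so is `G`. -/
theorem stmt14 {V₁ V₂ : Type*} [AddCommGroup V₁] [Module ℝ V₁] [FiniteDimensional ℝ V₁]
    [AddCommGroup V₂] [Module ℝ V₂] [FiniteDimensional ℝ V₂]
    (Φ₁ : GT V₁ →ₗ[ℝ] GT V₁) (Ep₁ Em₁ : GT V₁) (G₁ : GT V₁ →ₗ[ℝ] GT V₁)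
    (Φ₂ : GT V₂ →ₗ[ℝ] GT V₂) (Ep₂ Em₂ : GT V₂) (G₂ : GT V₂ →ₗ[ℝ] GT V₂)
    (hskew₁ : ∀ u v : GT V₁, gpair (Φ₁ u) v = - gpair u (Φ₁ v))
    (hsq₁ : ∀ w : GT V₁,
      Φ₁ (Φ₁ w) = -w + (2 * gpair Em₁ w) • Ep₁ + (2 * gpair Ep₁ w) • Em₁)
    (hpp₁ : gpair Ep₁ Ep₁ = 0) (hmm₁ : gpair Em₁ Em₁ = 0)
    (hpm₁ : 2 * gpair Ep₁ Em₁ = 1)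
    (hGsa₁ : ∀ u v : GT V₁, gpair (G₁ u) v = gpair u (G₁ v))
    (hGsq₁ : ∀ w : GT V₁, G₁ (G₁ w) = w)
    (hGc₁ : ∀ w : GT V₁,
      -(Φ₁ (G₁ (Φ₁ w))) = G₁ w - (2 * gpair Ep₁ w) • Ep₁ - (2 * gpair Em₁ w) • Em₁)
    (hskew₂ : ∀ u v : GT V₂, gpair (Φ₂ u) v = - gpair u (Φ₂ v))
    (hsq₂ : ∀ w : GT V₂,
      Φ₂ (Φ₂ w) = -w + (2 * gpair Em₂ w) • Ep₂ + (2 * gpair Ep₂ w) • Em₂)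
    (hpp₂ : gpair Ep₂ Ep₂ = 0) (hmm₂ : gpair Em₂ Em₂ = 0)
    (hpm₂ : 2 * gpair Ep₂ Em₂ = 1)
    (hGsa₂ : ∀ u v : GT V₂, gpair (G₂ u) v = gpair u (G₂ v))
    (hGsq₂ : ∀ w : GT V₂, G₂ (G₂ w) = w)
    (hGc₂ : ∀ w : GT V₂,
      -(Φ₂ (G₂ (Φ₂ w))) = G₂ w - (2 * gpair Ep₂ w) • Ep₂ - (2 * gpair Em₂ w) • Em₂) :
    ∀ J₁ : GT V₁ × GT V₂ → GT V₁ × GT V₂,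
      (J₁ = fun p =>
        (Φ₁ p.1 - (2 * gpair Ep₂ p.2) • Ep₁ - (2 * gpair Em₂ p.2) • Em₁,
         Φ₂ p.2 + (2 * gpair Ep₁ p.1) • Ep₂ + (2 * gpair Em₁ p.1) • Em₂)) →
      ∀ G : GT V₁ × GT V₂ → GT V₁ × GT V₂,
      (G = fun p => (G₁ p.1, G₂ p.2)) →
      ∀ J₂ : GT V₁ × GT V₂ → GT V₁ × GT V₂, (J₂ = G ∘ J₁) →
      (∀ p : GT V₁ × GT V₂, G (J₁ p) = J₁ (G p)) ∧
      (∀ p q : GT V₁ × GT V₂, gpairProd (J₂ p) q = - gpairProd p (J₂ q)) ∧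
      (∀ p : GT V₁ × GT V₂, J₂ (J₂ p) = -p) ∧
      (∀ p : GT V₁ × GT V₂, J₁ (J₂ p) = J₂ (J₁ p)) ∧
      (∀ p : GT V₁ × GT V₂, -(J₁ (J₂ p)) = G p) ∧
      ((∀ w : GT V₁, w ≠ 0 → 0 < gpair (G₁ w) w) →
       (∀ w : GT V₂, w ≠ 0 → 0 < gpair (G₂ w) w) →
       ∀ p : GT V₁ × GT V₂, p ≠ 0 → 0 < gpairProd (G p) p) := by
  intro J₁ hJ₁ G hG J₂ hJ₂
  obtain ⟨hΦp₁, hΦm₁, hGp₁, hGm₁, hpΦ₁, hmΦ₁, hpG₁, hmG₁, hcomm₁⟩ :=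
    contact_metric_identities hskew₁ hsq₁ hpp₁ hmm₁ hpm₁ hGsa₁ hGc₁
  obtain ⟨hΦp₂, hΦm₂, hGp₂, hGm₂, hpΦ₂, hmΦ₂, hpG₂, hmG₂, hcomm₂⟩ :=
    contact_metric_identities hskew₂ hsq₂ hpp₂ hmm₂ hpm₂ hGsa₂ hGc₂
  have hcomm : ∀ p, G (J₁ p) = J₁ (G p) := by
    intro p
    simp only [hJ₁, hG, map_sub, map_add, map_smul, hGp₁, hGm₁, hGp₂, hGm₂, hpG₁, hmG₁,
      hpG₂, hmG₂, hcomm₁, hcomm₂]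
    exact Prod.ext (sub_right_comm _ _ _) (add_right_comm _ _ _)
  have hJ₁sq : ∀ p, J₁ (J₁ p) = -p := by
    intro p
    have hmp₁ : 2 * gpair Em₁ Ep₁ = 1 := by rw [gpair_comm, hpm₁]
    have hmp₂ : 2 * gpair Em₂ Ep₂ = 1 := by rw [gpair_comm, hpm₂]
    have hpm₁' : gpair Ep₁ Em₁ = 1 / 2 := by linarith
    have hmp₁' : gpair Em₁ Ep₁ = 1 / 2 := by linarith
    have hpm₂' : gpair Ep₂ Em₂ = 1 / 2 := by linarith
    have hmp₂' : gpair Em₂ Ep₂ = 1 / 2 := by linarith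
    simp only [hJ₁, map_sub, map_add, map_smul, hΦp₁, hΦm₁, hΦp₂, hΦm₂, hsq₁, hsq₂,
      gpair_add_right, gpair_sub_right, gpair_smul_right, hpΦ₁, hmΦ₁, hpΦ₂, hmΦ₂,
      hpp₁, hmm₁, hpp₂, hmm₂, hpm₁', hmp₁', hpm₂', hmp₂']
    refine Prod.ext ?_ ?_
    · simp only [Prod.fst_neg]; module
    · simp only [Prod.snd_neg]; module
  have hJ₁skew : ∀ p q, gpairProd (J₁ p) q = -gpairProd p (J₁ q) := by
    intro p q
    simp only [hJ₁, gpairProd, gpair_add_left, gpair_sub_left, gpair_smul_left,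
      gpair_add_right, gpair_sub_right, gpair_smul_right, hskew₁, hskew₂,
      gpair_comm p.1 Ep₁, gpair_comm p.1 Em₁, gpair_comm p.2 Ep₂, gpair_comm p.2 Em₂]
    ring
  have hGsa : ∀ p q, gpairProd (G p) q = gpairProd p (G q) := by
    intro p q
    simp only [hG, gpairProd, hGsa₁, hGsa₂]
  have hGsq : ∀ p, G (G p) = p := by
    intro p
    simp only [hG, hGsq₁, hGsq₂]
  have hGneg : ∀ p, G (-p) = -G p := by
    intro p
    simp only [hG, Prod.fst_neg, Prod.snd_neg, map_neg, Prod.neg_mk]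
  subst hJ₂
  simp only [Function.comp_apply]
  refine ⟨hcomm, fun p q => ?_, fun p => ?_, fun p => ?_, fun p => ?_, fun h₁ h₂ p hp => ?_⟩
  · rw [hGsa, hJ₁skew, hcomm]
  · rw [← hcomm, hGsq, hJ₁sq]
  · rw [hcomm, hcomm, hcomm]
  · rw [← hcomm, hJ₁sq, hGneg, neg_neg]
  · simp only [hG, gpairProd]
    by_cases h : p.1 = 0
    · have h' : p.2 ≠ 0 := fun h' => hp (Prod.ext h h')
      exact add_pos_of_nonneg_of_pos (gpair_metric_nonneg h₁ _) (h₂ _ h')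
    · exact add_pos_of_pos_of_nonneg (h₁ _ h) (gpair_metric_nonneg h₂ _)
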